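/- arXiv:2604.11147 — 3 statements merged into one kernel-verified Lean document; each statement's English description precedes it below -/
import Mathlib

section
/- Let E be a nonempty compact convex subset of a finite-dimensional real inner product space V and let F be a face of E. Then there exists a finite chain of faces F = F_n ⊊ F_{n-1} ⊊ ⋯ ⊊ F_1 ⊊ F_0 = E which is maximal, in the sense that for each i ∈ {1,…,n} there is no face of E strictly contained between F_i and F_{i-1}. -/
open scoped RealInnerProductSpace

variable {V : Type*} [NormedAddCommGroup V] [InnerProductSpace ℝ V]

/-- `F` is a face of the convex set `E`: `F` is a convex subset of `E` such that whenever
`x, y ∈ E` and the relative interior of the segment `[x,y]` (the open segment) meets `F`,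
the whole segment `[x,y]` is contained in `F`. -/
def IsFace (E F : Set V) : Prop :=
  F ⊆ E ∧ Convex ℝ F ∧
    ∀ x ∈ E, ∀ y ∈ E, (openSegment ℝ x y ∩ F).Nonempty → segment ℝ x y ⊆ F

/-- A point on the line through `y` and a relative interior point `x` of `F` can be pushed past `x`
while staying in `F`. -/
theorem exists_mem_openSegment_of_mem_intrinsicInterior {F : Set V} {x y : V}
    (hx : x ∈ intrinsicInterior ℝ F) (hy : y ∈ affineSpan ℝ F) :
    ∃ z ∈ F, x ∈ openSegment ℝ z y := by
  obtain ⟨x', hx', rfl⟩ := mem_intrinsicInterior.1 hx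
  let f : ℝ → affineSpan ℝ F := fun t =>
    ⟨AffineMap.lineMap y (x' : V) t, AffineMap.lineMap_mem t hy x'.2⟩
  have hf : Continuous f := by
    refine Continuous.subtype_mk ?_ _
    exact AffineMap.lineMap_continuous
  have hf1 : f 1 = x' := Subtype.ext (by simp [f])
  have hmem : ∀ᶠ t in nhds (1 : ℝ), f t ∈ interior ((↑) ⁻¹' F : Set (affineSpan ℝ F)) :=
    hf.continuousAt.eventually_mem (by rw [hf1]; exact isOpen_interior.mem_nhds hx')
  obtain ⟨t, ht, ht1⟩ :=
    ((hmem.filter_mono nhdsWithin_le_nhds).and (self_mem_nhdsWithin (s := Set.Ioi 1))).exists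
  have ht1 : (1 : ℝ) < t := ht1
  have ht0 : 0 < t := one_pos.trans ht1
  refine ⟨f t, interior_subset (s := ((↑) ⁻¹' F : Set (affineSpan ℝ F))) ht, t⁻¹, 1 - t⁻¹,
    inv_pos.2 ht0, sub_pos.2 (inv_lt_one_of_one_lt₀ ht1),
    by ring, ?_⟩
  simp only [f, AffineMap.lineMap_apply_module]
  match_scalars <;> field_simp <;> ring

/-- Nested faces, the smaller of which is nonempty, coincide if they span the same directions. -/
theorem IsFace.eq_of_vectorSpan_eq [FiniteDimensional ℝ V] {E F G : Set V} (hF : IsFace E F)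
    (hG : IsFace E G) (hFG : F ⊆ G) (hne : F.Nonempty)
    (hspan : vectorSpan ℝ F = vectorSpan ℝ G) : F = G := by
  refine hFG.antisymm fun y hy => ?_
  obtain ⟨x, hx⟩ := hne.intrinsicInterior hF.2.1
  have hxF := intrinsicInterior_subset hx
  have hyF : y ∈ affineSpan ℝ F := by
    have hsub : y -ᵥ x ∈ vectorSpan ℝ F := hspan ▸ vsub_mem_vectorSpan ℝ hy (hFG hxF)
    simpa using vadd_mem_affineSpan_of_mem_affineSpan_of_mem_vectorSpan
      (mem_affineSpan ℝ hxF) hsub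
  obtain ⟨z, hz, hxz⟩ := exists_mem_openSegment_of_mem_intrinsicInterior hx hyF
  exact hF.2.2 z (hF.1 hz) y (hG.1 hy) ⟨x, hxz, hxF⟩ (right_mem_segment ℝ z y)

open Classical in
/-- The dimension of a convex set plus one, with value `0` on the empty set. -/
noncomputable def faceRank (F : Set V) : ℕ :=
  if F.Nonempty then Module.finrank ℝ (vectorSpan ℝ F) + 1 else 0

theorem faceRank_le [FiniteDimensional ℝ V] (F : Set V) :
    faceRank F ≤ Module.finrank ℝ V + 1 := by
  have := Submodule.finrank_le (vectorSpan ℝ F)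
  unfold faceRank
  split_ifs <;> omega

theorem IsFace.faceRank_lt [FiniteDimensional ℝ V] {E F G : Set V} (hF : IsFace E F)
    (hG : IsFace E G) (hFG : F ⊂ G) : faceRank F < faceRank G := by
  have hGne : G.Nonempty := Set.nonempty_of_ssubset' hFG
  by_cases hne : F.Nonempty
  · have hle := vectorSpan_mono ℝ hFG.subset
    have hlt : vectorSpan ℝ F < vectorSpan ℝ G :=
      hle.lt_of_ne fun h => hFG.ne (hF.eq_of_vectorSpan_eq hG hFG.subset hne h)
    simpa [faceRank, hne, hGne] using Submodule.finrank_lt_finrank_of_lt hlt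
  · simp [faceRank, hne, hGne]

theorem isFace_self {E : Set V} (hE : Convex ℝ E) : IsFace E E :=
  ⟨subset_rfl, hE, fun _ hx _ hy _ => hE.segment_subset hx hy⟩

theorem maximal_chain_of_faces [FiniteDimensional ℝ V]
    (E F : Set V) (hne : E.Nonempty) (hcomp : IsCompact E) (hconv : Convex ℝ E)
    (hF : IsFace E F) :
    ∃ (n : ℕ) (c : Fin (n + 1) → Set V),
      c 0 = E ∧ c (Fin.last n) = F ∧
      (∀ i, IsFace E (c i)) ∧
      (∀ i : Fin n, c i.succ ⊂ c i.castSucc) ∧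
      (∀ i : Fin n, ∀ G : Set V, IsFace E G →
        ¬(c i.succ ⊂ G ∧ G ⊂ c i.castSucc)) := by
  let S := {G : Set V // IsFace E G}
  have hrank : StrictMono fun G : S => faceRank G.1 :=
    fun G H hGH => G.2.faceRank_lt H.2 hGH
  have hcorank : StrictAnti fun G : S => Module.finrank ℝ V + 1 - faceRank G.1 :=
    fun G H hGH => by
      have := hrank hGH
      have := faceRank_le H.1
      dsimp only at *
      omega
  have : WellFoundedLT S := hrank.wellFoundedLT
  have : WellFoundedGT S := hcorank.wellFoundedGT
  obtain ⟨a, ha0, n, han, hcov⟩ := exists_covBy_seq_of_wellFoundedLT_wellFoundedGT_of_le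
    (show (⟨F, hF⟩ : S) ≤ ⟨E, isFace_self hconv⟩ from hF.1)
  have hstep (i : Fin n) : a (n - (i.succ : ℕ)) ⋖ a (n - (i.castSucc : ℕ)) := by
    have hi := i.2
    have h := hcov (n - (i + 1)) (by omega)
    rwa [show n - (i + 1) + 1 = n - (i : ℕ) by omega] at h
  refine ⟨n, fun i => (a (n - i)).1, by simp [han], by simp [ha0], fun i => (a (n - i)).2,
    fun i => (hstep i).lt, ?_⟩
  rintro i G hG ⟨h₁, h₂⟩
  exact (hstep i).2 (c := ⟨G, hG⟩) h₁ h₂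
end

section
/- Let E be a nonempty compact convex subset of a finite-dimensional real inner product space V, and let F be a nonempty proper face of E that is maximal among proper faces, in the sense that there is no face G of E with F ⊊ G ⊊ E. Then F is an exposed face of E. -/
open scoped RealInnerProductSpace

variable {V : Type*} [NormedAddCommGroup V] [InnerProductSpace ℝ V]

/-- The exposed face of `C` in the direction `u`:
`F_u(C) = {x ∈ C : ⟪x,u⟫ = max_{y ∈ C} ⟪y,u⟫}`. -/
def expFace (C : Set V) (u : V) : Set V :=
  {x ∈ C | ∀ y ∈ C, ⟪y, u⟫ ≤ ⟪x, u⟫}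

/-- An exposed face of a convex set is a face. -/
theorem isFace_expFace {E : Set V} (hE : Convex ℝ E) (u : V) : IsFace E (expFace E u) := by
  refine ⟨fun x hx => hx.1, ?_, ?_⟩
  · rintro x ⟨hx, hx'⟩ y ⟨hy, hy'⟩ a b ha hb hab
    refine ⟨hE hx hy ha hb hab, fun z hz => ?_⟩
    rw [inner_add_left, real_inner_smul_left, real_inner_smul_left]
    have h1 := mul_le_mul_of_nonneg_left (hx' z hz) ha
    have h2 := mul_le_mul_of_nonneg_left (hy' z hz) hb
    have h3 : ⟪z, u⟫ = a * ⟪z, u⟫ + b * ⟪z, u⟫ := by rw [← add_mul, hab, one_mul]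
    linarith
  · rintro x hx y hy ⟨_, ⟨a, b, ha, hb, hab, rfl⟩, -, hm⟩ _ ⟨c, d, hc, hd, hcd, rfl⟩
    refine ⟨hE hx hy hc hd hcd, fun z hz => ?_⟩
    have h1 := hm x hx
    have h2 := hm y hy
    have h3 := hm z hz
    rw [inner_add_left, real_inner_smul_left, real_inner_smul_left] at *
    obtain rfl : b = 1 - a := by linarith
    obtain rfl : d = 1 - c := by linarith
    have hxy : ⟪x, u⟫ = ⟪y, u⟫ := by
      apply le_antisymm
      · exact le_of_mul_le_mul_left (by linarith) hb
      · exact le_of_mul_le_mul_left (by linarith) ha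
    rw [hxy] at h3 ⊢
    linarith

/-- A convex set in a finite-dimensional space has a point `p` such that the preimage of the set
under the orthogonal projection onto its affine span, written with base point `p`, is a
neighbourhood of `p`. -/
theorem exists_mem_interior_preimage_projection [FiniteDimensional ℝ V] {E : Set V}
    (hne : E.Nonempty) (hE : Convex ℝ E) :
    ∃ p ∈ E, p ∈ interior {x | p + (vectorSpan ℝ E).starProjection (x - p) ∈ E} := by
  obtain ⟨p, hp⟩ := hne.intrinsicInterior hE
  have hpE : p ∈ E := intrinsicInterior_subset hp
  refine ⟨p, hpE, ?_⟩
  obtain ⟨q, hq, rfl⟩ := mem_intrinsicInterior.1 hp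
  rw [mem_interior_iff_mem_nhds, Metric.mem_nhds_iff] at hq ⊢
  obtain ⟨ε, hε, hball⟩ := hq
  refine ⟨ε, hε, fun x hx => ?_⟩
  have hmem : (q : V) + (vectorSpan ℝ E).starProjection (x - q) ∈ affineSpan ℝ E := by
    rw [add_comm]
    refine AffineSubspace.vadd_mem_of_mem_direction ?_ q.2
    rw [direction_affineSpan]
    exact Submodule.starProjection_apply_mem _ _
  refine @hball ⟨_, hmem⟩ ?_
  rw [Metric.mem_ball, Subtype.dist_eq, dist_eq_norm, add_sub_cancel_left]
  rw [Metric.mem_ball, dist_eq_norm] at hx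
  exact (Submodule.norm_starProjection_apply_le _ _).trans_lt hx

/-- A nonempty proper face of a convex set lies in a proper exposed face. -/
theorem IsFace.exists_subset_expFace [FiniteDimensional ℝ V] {E F : Set V}
    (hE : Convex ℝ E) (hF : IsFace E F) (hFne : F.Nonempty) (hFE : F ≠ E) :
    ∃ u : V, u ≠ 0 ∧ F ⊆ expFace E u ∧ expFace E u ≠ E := by
  obtain ⟨p, hpE, hp⟩ := exists_mem_interior_preimage_projection (hFne.mono hF.1) hE
  set P := (vectorSpan ℝ E).starProjection with hP
  set T : Set V := {x | p + P (x - p) ∈ E} with hT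
  have hfix : ∀ x ∈ affineSpan ℝ E, p + P (x - p) = x := by
    intro x hx
    have : x - p ∈ vectorSpan ℝ E := by
      rw [← direction_affineSpan]
      exact AffineSubspace.vsub_mem_direction hx (subset_affineSpan ℝ E hpE)
    rw [hP, Submodule.starProjection_eq_self_iff.2 this, add_sub_cancel]
  have hET : E ⊆ T := fun x hx => by
    rw [hT, Set.mem_ofPred_eq, hfix x (subset_affineSpan ℝ E hx)]
    exact hx
  have hTconv : Convex ℝ T := by
    intro x hx y hy a b ha hb hab
    have h := hE hx hy ha hb hab
    rw [hT, Set.mem_ofPred_eq]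
    convert h using 1
    obtain rfl : b = 1 - a := by linarith
    simp only [map_sub, map_add, map_smul]
    module
  have hdisj : Disjoint (interior T) F := by
    rw [Set.disjoint_left]
    intro b hb hbF
    refine hFE (hF.1.antisymm fun y hy => ?_)
    have hcont : Filter.Tendsto (fun t : ℝ => AffineMap.lineMap (k := ℝ) y b t)
        (nhdsWithin 1 (Set.Ioi 1)) (nhds b) := by
      have h : Continuous fun t : ℝ => AffineMap.lineMap (k := ℝ) y b t :=
        AffineMap.lineMap_continuous
      simpa using (h.tendsto 1).mono_left nhdsWithin_le_nhds
    obtain ⟨t, htT, ht⟩ := ((hcont.eventually (mem_interior_iff_mem_nhds.1 hb)).and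
      self_mem_nhdsWithin).exists
    have ht1 : (1 : ℝ) < t := ht
    have ht0 : 0 < t := by linarith
    have hz : AffineMap.lineMap y b t ∈ E := by
      have h : p + P (AffineMap.lineMap y b t - p) ∈ E := htT
      rwa [hfix _ (AffineMap.lineMap_mem t (subset_affineSpan ℝ E hy)
        (subset_affineSpan ℝ E (hF.1 hbF)))] at h
    refine hF.2.2 y hy _ hz ⟨b, ⟨1 - t⁻¹, t⁻¹, ?_, inv_pos.2 ht0, by ring, ?_⟩, hbF⟩
      (left_mem_segment ℝ _ _)
    · linarith [inv_lt_one_of_one_lt₀ ht1]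
    · rw [AffineMap.lineMap_apply_module]
      match_scalars <;> field_simp
      ring
  obtain ⟨f, c, hf, hfF⟩ :=
    geometric_hahn_banach_open hTconv.interior isOpen_interior hF.2.1 hdisj
  have hfE : ∀ y ∈ E, f y ≤ c := by
    intro y hy
    have hcl : y ∈ closure (interior T) := by
      rw [hTconv.closure_interior_eq_closure_of_nonempty_interior ⟨p, hp⟩]
      exact subset_closure (hET hy)
    exact closure_minimal (fun a ha => (hf a ha).le) (isClosed_le f.continuous continuous_const) hcl
  have hinner : ∀ x, ⟪x, (InnerProductSpace.toDual ℝ V).symm f⟫ = f x := fun x => by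
    rw [real_inner_comm, InnerProductSpace.toDual_symm_apply]
  obtain ⟨b, hb⟩ := hFne
  have hpb : f p < f b := (hf p hp).trans_le (hfF b hb)
  refine ⟨(InnerProductSpace.toDual ℝ V).symm f, ?_, ?_, ?_⟩
  · intro h0
    have h1 := hinner p
    have h2 := hinner b
    rw [h0, inner_zero_right] at h1 h2
    linarith
  · intro x hx
    refine ⟨hF.1 hx, fun y hy => ?_⟩
    rw [hinner, hinner]
    exact (hfE y hy).trans (hfF x hx)
  · intro h
    have hpu : p ∈ expFace E ((InnerProductSpace.toDual ℝ V).symm f) := h.symm ▸ hpE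
    have := hpu.2 b (hF.1 hb)
    rw [hinner, hinner] at this
    linarith

theorem maximal_face_is_exposed [FiniteDimensional ℝ V]
    (E F : Set V) (hne : E.Nonempty) (hcomp : IsCompact E) (hconv : Convex ℝ E)
    (hF : IsFace E F) (hFne : F.Nonempty) (hFproper : F ≠ E)
    (hmax : ∀ G : Set V, IsFace E G → ¬(F ⊂ G ∧ G ⊂ E)) :
    ∃ u : V, u ≠ 0 ∧ F = expFace E u := by
  obtain ⟨u, hu, hsub, hproper⟩ := hF.exists_subset_expFace hconv hFne hFproper
  refine ⟨u, hu, by_contra fun hFu => ?_⟩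
  have hface := isFace_expFace hconv u
  exact hmax _ hface ⟨hsub.ssubset_of_ne hFu, hface.1.ssubset_of_ne hproper⟩
end

section
/- Let E be a nonempty compact convex subset of a finite-dimensional real inner product space V. Then every nonempty proper face of E is contained in a proper exposed face of E. -/
open scoped RealInnerProductSpace

variable {V : Type*} [NormedAddCommGroup V] [InnerProductSpace ℝ V]

open Filter Topology in
/-- A face containing an interior point, relative to a subspace `W` of directions, is everything. -/
theorem IsFace.eq_of_mem_interior {E F : Set V} (hF : IsFace E F) (W : Submodule ℝ V) (z : V)
    (hW : ∀ y ∈ E, y - z ∈ W) {w : W} (hw : w ∈ interior {v : W | z + v ∈ E})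
    (hwF : z + w ∈ F) : F = E := by
  refine hF.1.antisymm fun y hy => ?_
  set y' : W := ⟨y - z, hW y hy⟩
  have hc : Tendsto (fun t : ℝ => w + t • (w - y')) (𝓝[>] 0) (𝓝 w) := by
    have : Continuous fun t : ℝ => w + t • (w - y') := by fun_prop
    simpa using (this.tendsto 0).mono_left (nhdsWithin_le_nhds (s := Set.Ioi (0 : ℝ)))
  obtain ⟨t, htE, ht⟩ :=
    ((hc.eventually (mem_interior_iff_mem_nhds.1 hw)).and self_mem_nhdsWithin).exists
  have ht : 0 < t := ht
  refine hF.2.2 _ htE y hy ⟨z + w, ?_, hwF⟩ (right_mem_segment ℝ _ _)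
  refine ⟨1 / (1 + t), t / (1 + t), by positivity, by positivity, by field_simp, ?_⟩
  have hy' : (y : V) = z + y' := by simp [y']
  rw [hy']
  push_cast
  match_scalars <;> field_simp <;> ring

/-- A convex set is a neighborhood of one of its points in the direction of its affine span. -/
theorem Convex.exists_interior_direction_nonempty [FiniteDimensional ℝ V] {E : Set V}
    (hconv : Convex ℝ E) (hne : E.Nonempty) :
    ∃ z ∈ E, (interior {v : (affineSpan ℝ E).direction | z + v ∈ E}).Nonempty := by
  obtain ⟨z, hz⟩ := hne.intrinsicInterior hconv
  refine ⟨z, intrinsicInterior_subset hz, 0, ?_⟩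
  obtain ⟨y, hy, rfl⟩ := mem_intrinsicInterior.1 hz
  have hc : Continuous fun v : (affineSpan ℝ E).direction =>
      (⟨(v : V) + y, AffineSubspace.vadd_mem_of_mem_direction v.2 y.2⟩ : affineSpan ℝ E) := by
    fun_prop
  refine mem_interior_iff_mem_nhds.2 ?_
  have h := hc.continuousAt.preimage_mem_nhds (x := 0)
    (t := ((↑) : affineSpan ℝ E → V) ⁻¹' E) (by simpa using mem_interior_iff_mem_nhds.1 hy)
  filter_upwards [h] with v hv
  simpa [add_comm] using hv

theorem face_subset_exposed_face [FiniteDimensional ℝ V]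
    (E : Set V) (hne : E.Nonempty) (hcomp : IsCompact E) (hconv : Convex ℝ E)
    (F : Set V) (hF : IsFace E F) (hFne : F.Nonempty) (hFproper : F ≠ E) :
    ∃ u : V, u ≠ 0 ∧ F ⊆ expFace E u ∧ (expFace E u).Nonempty ∧ expFace E u ≠ E := by
  obtain ⟨z, hz, hint⟩ := hconv.exists_interior_direction_nonempty hne
  set W := (affineSpan ℝ E).direction
  have hW : ∀ y ∈ E, y - z ∈ W := fun y hy =>
    AffineSubspace.vsub_mem_direction (subset_affineSpan ℝ E hy) (subset_affineSpan ℝ E hz)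
  set A : Set W := {v | z + v ∈ E}
  have hA : ∀ {G : Set V}, Convex ℝ G → Convex ℝ {v : W | z + v ∈ G} := fun hG =>
    (hG.translate_preimage_right z).linear_preimage W.subtype
  have hdisj : Disjoint (interior A) {v : W | z + v ∈ F} := by
    rw [Set.disjoint_left]
    exact fun w hw hwF => hFproper (hF.eq_of_mem_interior W z hW hw hwF)
  obtain ⟨f, c, hlt, hge⟩ :=
    geometric_hahn_banach_open (hA hconv).interior isOpen_interior (hA hF.2.1) hdisj
  have hle : ∀ v ∈ A, f v ≤ c := by
    intro v hv
    have : v ∈ closure (interior A) := by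
      rw [(hA hconv).closure_interior_eq_closure_of_nonempty_interior hint]
      exact subset_closure hv
    exact closure_minimal (fun a ha => (hlt a ha).le)
      (isClosed_le f.continuous continuous_const) this
  set u : W := (InnerProductSpace.toDual ℝ W).symm f
  have hu : ∀ (y : V) (hy : y ∈ E), ⟪y, (u : V)⟫ = ⟪z, (u : V)⟫ + f ⟨y - z, hW y hy⟩ := by
    intro y hy
    rw [← InnerProductSpace.toDual_symm_apply (𝕜 := ℝ) (y := f), Submodule.coe_inner,
      real_inner_comm (y - z), inner_sub_left]
    ring
  have hsub : F ⊆ expFace E u := by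
    refine fun x hx => ⟨hF.1 hx, fun y hy => ?_⟩
    rw [hu y hy, hu x (hF.1 hx)]
    have h₁ := hle ⟨y - z, hW y hy⟩ (by simpa [A] using hy)
    have h₂ := hge ⟨x - z, hW x (hF.1 hx)⟩ (by simpa using hx)
    linarith
  obtain ⟨x, hx⟩ := hFne
  obtain ⟨w, hw⟩ := hint
  have hwE : z + w ∈ E := interior_subset (s := A) hw
  have hstrict : ⟪z + w, (u : V)⟫ < ⟪x, (u : V)⟫ := by
    rw [hu _ hwE, hu x (hF.1 hx)]
    have h₁ := hlt w hw
    have h₂ := hge ⟨x - z, hW x (hF.1 hx)⟩ (by simpa using hx)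
    simp only [add_sub_cancel_left]
    linarith
  refine ⟨u, fun h0 => ?_, hsub, ⟨x, hsub hx⟩, fun heq => ?_⟩
  · simp [h0] at hstrict
  · have hmem : z + (w : V) ∈ expFace E u := by rwa [heq]
    exact (hmem.2 x (hF.1 hx)).not_gt hstrict
end
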